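/- Let W : ℝ × ℝⁿ → ℝ and F : ℝ × ℝⁿ → ℝⁿ be smooth (C^∞) functions satisfying the classical master homotopy equation ∂W/∂t(t,x) + ⟨∇_x W(t,x), F(t,x)⟩ = 0 for all (t,x). Let x₀ : ℝ → ℝⁿ be a differentiable curve of critical points, i.e. ∇_x W(t, x₀(t)) = 0 for all t, with invertible Hessian A(t) = (∂_i∂_j W)(t, x₀(t)) for every t. Let J(t) = (D_x F)(t, x₀(t)) be the n×n Jacobian matrix of F in the x-variables evaluated along the critical curve. Then the Hessian along the critical curve satisfies the differential equation A'(t) = −( A(t)·J(t) + J(t)ᵀ·A(t) ) for all t. -/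

import Mathlib

open scoped BigOperators
open Matrix

/-- Gradient of `W` in the `x`-variables: `(∇ₓ W)(t,x) i = ∂W/∂xᵢ (t,x)`. -/
noncomputable def gradx (n : ℕ) (W : ℝ × (Fin n → ℝ) → ℝ) (t : ℝ) (x : Fin n → ℝ) :
    Fin n → ℝ :=
  fun i => fderiv ℝ (fun y => W (t, y)) x (Pi.single i 1)

/-- Hessian of `W` in the `x`-variables: `(∂ᵢ∂ⱼ W)(t,x)`. -/
noncomputable def hessx (n : ℕ) (W : ℝ × (Fin n → ℝ) → ℝ) (t : ℝ) (x : Fin n → ℝ) :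
    Matrix (Fin n) (Fin n) ℝ :=
  Matrix.of fun i j => fderiv ℝ (fun y => gradx n W t y j) x (Pi.single i 1)

/-- Jacobian matrix of `F` in the `x`-variables: `(∂Fᵢ/∂xⱼ)(t,x)`. -/
noncomputable def jacx (n : ℕ) (F : ℝ × (Fin n → ℝ) → (Fin n → ℝ)) (t : ℝ) (x : Fin n → ℝ) :
    Matrix (Fin n) (Fin n) ℝ :=
  Matrix.of fun i j => fderiv ℝ (fun y => F (t, y) i) x (Pi.single j 1)

theorem ContinuousLinearMap.apply_eq_sum_single {ι M : Type*} [Fintype ι] [DecidableEq ι]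
    [AddCommGroup M] [Module ℝ M] [TopologicalSpace M] (L : (ι → ℝ) →L[ℝ] M) (z : ι → ℝ) :
    L z = ∑ k, z k • L (Pi.single k 1) := by
  conv_lhs => rw [pi_eq_sum_univ' z]
  simp only [map_sum, map_smul]

theorem fderiv_comp_prodMk_left {E M G : Type*} [NormedAddCommGroup E] [NormedSpace ℝ E]
    [NormedAddCommGroup M] [NormedSpace ℝ M] [NormedAddCommGroup G] [NormedSpace ℝ G]
    {f : G × E → M} {t : G} {x : E} (hf : DifferentiableAt ℝ f (t, x)) (v : E) :
    fderiv ℝ (fun y => f (t, y)) x v = fderiv ℝ f (t, x) (0, v) := by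
  have h := hf.hasFDerivAt.comp x (hasFDerivAt_prodMk_right (𝕜 := ℝ) t x)
  have h' : fderiv ℝ (fun y => f (t, y)) x = _ := h.fderiv
  rw [h']
  simp

theorem gradx_eq_fderiv {n : ℕ} {W : ℝ × (Fin n → ℝ) → ℝ} (hW : Differentiable ℝ W)
    (t : ℝ) (x : Fin n → ℝ) (i : Fin n) :
    gradx n W t x i = fderiv ℝ W (t, x) (0, Pi.single i 1) :=
  fderiv_comp_prodMk_left (hW _) _

theorem hessx_eq_fderiv {n : ℕ} {W : ℝ × (Fin n → ℝ) → ℝ} (hW : Differentiable ℝ W)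
    (hW' : Differentiable ℝ (fderiv ℝ W)) (t : ℝ) (x : Fin n → ℝ) (i j : Fin n) :
    hessx n W t x i j =
      fderiv ℝ (fderiv ℝ W) (t, x) (0, Pi.single i 1) (0, Pi.single j 1) := by
  have h : (fun y => gradx n W t y j) =
      fun y => (fun p => fderiv ℝ W p (0, Pi.single j 1)) (t, y) :=
    funext fun y => gradx_eq_fderiv hW t y j
  have hd := (hW' (t, x)).hasFDerivAt.clm_apply
    (hasFDerivAt_const ((0 : ℝ), (Pi.single j 1 : Fin n → ℝ)) (t, x))
  rw [hessx, Matrix.of_apply, h, fderiv_comp_prodMk_left hd.differentiableAt, hd.fderiv]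
  simp

theorem jacx_eq_fderiv {n : ℕ} {F : ℝ × (Fin n → ℝ) → (Fin n → ℝ)} (hF : Differentiable ℝ F)
    (t : ℝ) (x : Fin n → ℝ) (i j : Fin n) :
    jacx n F t x i j = fderiv ℝ F (t, x) (0, Pi.single j 1) i := by
  have hd := hasFDerivAt_pi'.1 (hF (t, x)).hasFDerivAt i
  rw [jacx, Matrix.of_apply,
    fderiv_comp_prodMk_left (f := fun p => F p i) hd.differentiableAt, hd.fderiv]
  simp

theorem HasFDerivAt.const_prodMk {E M G : Type*} [NormedAddCommGroup E] [NormedSpace ℝ E]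
    [NormedAddCommGroup M] [NormedSpace ℝ M] [NormedAddCommGroup G] [NormedSpace ℝ G]
    {f : E → M} {f' : E →L[ℝ] M} {p : E} (hf : HasFDerivAt f f' p) (c : G) :
    HasFDerivAt (fun q => (c, f q)) ((0 : E →L[ℝ] G).prod f') p :=
  (hasFDerivAt_const c p).prodMk hf

theorem HasDerivAt.fderiv_clm_apply_comp {E M G : Type*} [NormedAddCommGroup E] [NormedSpace ℝ E]
    [NormedAddCommGroup M] [NormedSpace ℝ M] [NormedAddCommGroup G] [NormedSpace ℝ G]
    {γ : ℝ → E} {γ' : E} {t : ℝ} (hγ : HasDerivAt γ γ' t) {f : E → M →L[ℝ] G}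
    (hf : Differentiable ℝ f) (v : M) :
    HasDerivAt (fun s => f (γ s) v) (fderiv ℝ f (γ t) γ' v) t := by
  have hd := ((hf (γ t)).hasFDerivAt.clm_apply (hasFDerivAt_const v (γ t))).comp_hasDerivAt t hγ
  simpa [Function.comp_def] using hd

section Transport

variable {E : Type*} [NormedAddCommGroup E] [NormedSpace ℝ E]

/-- First variation of the transport equation `∂W/∂t + D_x W · F = 0`. -/
theorem fderiv_transport {W : ℝ × E → ℝ} {F : ℝ × E → E}
    (hW' : Differentiable ℝ (fderiv ℝ W)) (hF : Differentiable ℝ F)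
    (h : ∀ p, fderiv ℝ W p (1, F p) = 0) (p u : ℝ × E) :
    fderiv ℝ (fderiv ℝ W) p u (1, F p) + fderiv ℝ W p (0, fderiv ℝ F p u) = 0 := by
  have hd := (hW' p).hasFDerivAt.clm_apply ((hF p).hasFDerivAt.const_prodMk (1 : ℝ))
  have h0 := hd.unique ((funext h : (fun q => fderiv ℝ W q (1, F q)) = fun _ => 0) ▸
    hasFDerivAt_const (0 : ℝ) p)
  have := DFunLike.congr_fun h0 u
  simp only [_root_.add_apply, ContinuousLinearMap.comp_apply,
    ContinuousLinearMap.flip_apply, ContinuousLinearMap.prod_apply,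
    _root_.zero_apply] at this
  linarith

/-- Second variation of the transport equation `∂W/∂t + D_x W · F = 0`. -/
theorem fderiv_fderiv_transport {W : ℝ × E → ℝ} {F : ℝ × E → E}
    (hW' : Differentiable ℝ (fderiv ℝ W)) (hW'' : Differentiable ℝ (fderiv ℝ (fderiv ℝ W)))
    (hF : Differentiable ℝ F) (hF' : Differentiable ℝ (fderiv ℝ F))
    (h : ∀ p, fderiv ℝ W p (1, F p) = 0) (p u w : ℝ × E) :
    fderiv ℝ (fderiv ℝ (fderiv ℝ W)) p w u (1, F p)
      + fderiv ℝ (fderiv ℝ W) p u (0, fderiv ℝ F p w)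
      + fderiv ℝ (fderiv ℝ W) p w (0, fderiv ℝ F p u)
      + fderiv ℝ W p (0, fderiv ℝ (fderiv ℝ F) p w u) = 0 := by
  have hd₁ := ((hW'' p).hasFDerivAt.clm_apply (hasFDerivAt_const u p)).clm_apply
    ((hF p).hasFDerivAt.const_prodMk (1 : ℝ))
  have hd₂ := (hW' p).hasFDerivAt.clm_apply
    (((hF' p).hasFDerivAt.clm_apply (hasFDerivAt_const u p)).const_prodMk (0 : ℝ))
  have h0 := (hd₁.add hd₂).unique
    ((funext fun q => fderiv_transport hW' hF h q u :
      (fun q => fderiv ℝ (fderiv ℝ W) q u (1, F q)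
        + fderiv ℝ W q (0, fderiv ℝ F q u)) = fun _ => 0) ▸ hasFDerivAt_const (0 : ℝ) p)
  have := DFunLike.congr_fun h0 w
  simp only [_root_.add_apply, ContinuousLinearMap.comp_apply,
    ContinuousLinearMap.flip_apply, ContinuousLinearMap.prod_apply,
    _root_.zero_apply, map_zero, zero_add] at this
  linarith

end Transport

theorem fderiv_fderiv_comm {E M : Type*} [NormedAddCommGroup E] [NormedSpace ℝ E]
    [NormedAddCommGroup M] [NormedSpace ℝ M] {f : E → M} (hf : ContDiff ℝ 2 f) (p u v : E) :
    fderiv ℝ (fderiv ℝ f) p u v = fderiv ℝ (fderiv ℝ f) p v u :=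
  (hf.contDiffAt.isSymmSndFDerivAt (by simp)) u v

theorem fderiv_fderiv_fderiv_rotate {E M : Type*} [NormedAddCommGroup E] [NormedSpace ℝ E]
    [NormedAddCommGroup M] [NormedSpace ℝ M] {f : E → M} (hf : ContDiff ℝ 3 f) (p u v w : E) :
    fderiv ℝ (fderiv ℝ (fderiv ℝ f)) p u v w = fderiv ℝ (fderiv ℝ (fderiv ℝ f)) p w u v := by
  have hf₁ : ContDiff ℝ 2 (fderiv ℝ f) := hf.fderiv_right (by norm_num)
  have hd : HasFDerivAt (fderiv ℝ (fderiv ℝ f)) _ p :=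
    ((hf₁.fderiv_right (m := 1) (by norm_num)).differentiable (by norm_num) p).hasFDerivAt
  have hd' := fun a b =>
    (hd.clm_apply (hasFDerivAt_const a p)).clm_apply (hasFDerivAt_const b p)
  have hs : (fun q => fderiv ℝ (fderiv ℝ f) q v w) = fun q => fderiv ℝ (fderiv ℝ f) q w v :=
    funext fun q => fderiv_fderiv_comm (hf.of_le (by norm_num)) q v w
  have h := DFunLike.congr_fun ((hd' v w).unique (hs ▸ hd' w v)) u
  simp only [_root_.add_apply, ContinuousLinearMap.comp_apply,
    ContinuousLinearMap.flip_apply, _root_.zero_apply, map_zero, zero_add] at h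
  rw [h, fderiv_fderiv_comm hf₁]

/-- under the classical master homotopy equation, the Hessian
`A(t) = (∂ᵢ∂ⱼW)(t, x₀ t)` along the critical curve satisfies
`A'(t) = −(A(t)·J(t) + J(t)ᵀ·A(t))`, where `J(t) = (DₓF)(t, x₀ t)`. -/
theorem hessian_derivative_along_critical_curve (n : ℕ)
    (W : ℝ × (Fin n → ℝ) → ℝ) (F : ℝ × (Fin n → ℝ) → (Fin n → ℝ))
    (hW : ContDiff ℝ (⊤ : ℕ∞) W) (hF : ContDiff ℝ (⊤ : ℕ∞) F)
    (hmaster : ∀ (t : ℝ) (x : Fin n → ℝ),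
      deriv (fun s => W (s, x)) t + ∑ i, gradx n W t x i * F (t, x) i = 0)
    (x₀ : ℝ → Fin n → ℝ) (hx₀ : Differentiable ℝ x₀)
    (hcrit : ∀ t, gradx n W t (x₀ t) = 0)
    (hhess : ∀ t, IsUnit (hessx n W t (x₀ t)).det) :
    ∀ (t : ℝ) (i j : Fin n),
      deriv (fun s => hessx n W s (x₀ s) i j) t =
        (-(hessx n W t (x₀ t) * jacx n F t (x₀ t)
            + (jacx n F t (x₀ t))ᵀ * hessx n W t (x₀ t))) i j := by
  intro t i j
  have hW₁ : Differentiable ℝ W := hW.differentiable (by simp)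
  have hcW₁ : ContDiff ℝ (⊤ : ℕ∞) (fderiv ℝ W) := hW.fderiv_right (by simp)
  have hW₂ : Differentiable ℝ (fderiv ℝ W) := hcW₁.differentiable (by simp)
  have hcW₂ : ContDiff ℝ (⊤ : ℕ∞) (fderiv ℝ (fderiv ℝ W)) := hcW₁.fderiv_right (by simp)
  have hW₃ : Differentiable ℝ (fderiv ℝ (fderiv ℝ W)) := hcW₂.differentiable (by simp)
  have hF₁ : Differentiable ℝ F := hF.differentiable (by simp)
  have hcF₁ : ContDiff ℝ (⊤ : ℕ∞) (fderiv ℝ F) := hF.fderiv_right (by simp)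
  have hF₂ : Differentiable ℝ (fderiv ℝ F) := hcF₁.differentiable (by simp)
  have hsum : ∀ (L : ℝ × (Fin n → ℝ) →L[ℝ] ℝ) (z : Fin n → ℝ),
      L (0, z) = ∑ k, z k * L (0, Pi.single k 1) := fun L z => by
    simpa using
      (L.comp (ContinuousLinearMap.inr ℝ ℝ (Fin n → ℝ))).apply_eq_sum_single z
  have htransport : ∀ p, fderiv ℝ W p (1, F p) = 0 := by
    rintro ⟨s, x⟩
    have h₁ : HasDerivAt (fun r => W (r, x)) (fderiv ℝ W (s, x) (1, 0)) s :=
      (hW₁ (s, x)).hasFDerivAt.comp_hasDerivAt s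
        ((hasDerivAt_id s).prodMk (hasDerivAt_const s x))
    have h₂ : ((1 : ℝ), F (s, x)) = (1, 0) + (0, F (s, x)) := by simp
    rw [h₂, map_add, hsum, ← h₁.deriv]
    refine Eq.trans ?_ (hmaster s x)
    simp only [gradx_eq_fderiv hW₁, mul_comm]
  have hvert : ∀ s z, fderiv ℝ W (s, x₀ s) (0, z) = 0 := fun s z => by
    rw [hsum]
    refine Finset.sum_eq_zero fun k _ => ?_
    rw [← gradx_eq_fderiv hW₁, hcrit]
    simp
  have hcurve : HasDerivAt (fun s => (s, x₀ s)) (1, deriv x₀ t) t :=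
    (hasDerivAt_id t).prodMk (hx₀ t).hasDerivAt
  have hsymm := fderiv_fderiv_comm (contDiff_infty.1 hW 2)
  have hvel : deriv x₀ t = F (t, x₀ t) := by
    refine sub_eq_zero.1 (Matrix.eq_zero_of_mulVec_eq_zero (hhess t).ne_zero (funext fun k => ?_))
    have h₁ := fderiv_transport hW₂ hF₁ htransport (t, x₀ t) (0, Pi.single k 1)
    rw [hvert, add_zero] at h₁
    have h₂ := hcurve.fderiv_clm_apply_comp hW₂ (0, Pi.single k 1)
    have h₃ := h₂.deriv.symm.trans
      ((congrArg (deriv · t) (funext fun s => hvert s _)).trans (deriv_const t (0 : ℝ)))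
    rw [hsymm] at h₃
    have h₄ : ((0 : ℝ), deriv x₀ t - F (t, x₀ t)) = (1, deriv x₀ t) - (1, F (t, x₀ t)) := by simp
    have h₅ := hsum (fderiv ℝ (fderiv ℝ W) (t, x₀ t) (0, Pi.single k 1))
      (deriv x₀ t - F (t, x₀ t))
    rw [h₄, map_sub, h₁, h₃, sub_zero] at h₅
    simp only [Matrix.mulVec, dotProduct, hessx_eq_fderiv hW₁ hW₂, Pi.zero_apply]
    refine Eq.trans ?_ h₅.symm
    exact Finset.sum_congr rfl fun _ _ => mul_comm _ _
  have hderiv : HasDerivAt (fun s => hessx n W s (x₀ s) i j)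
      (fderiv ℝ (fderiv ℝ (fderiv ℝ W)) (t, x₀ t) (1, F (t, x₀ t))
        (0, Pi.single i 1) (0, Pi.single j 1)) t := by
    have hd : Differentiable ℝ fun p => fderiv ℝ (fderiv ℝ W) p (0, Pi.single i 1) :=
      fun p => (hW₃ p).clm_apply (differentiableAt_const _)
    have h := hcurve.fderiv_clm_apply_comp hd (0, Pi.single j 1)
    rw [((hW₃ (t, x₀ t)).hasFDerivAt.clm_apply (hasFDerivAt_const _ _)).fderiv] at h
    simpa [hessx_eq_fderiv hW₁ hW₂, hvel] using h
  have hsecond := fderiv_fderiv_transport hW₂ hW₃ hF₁ hF₂ htransport (t, x₀ t)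
    (0, Pi.single j 1) (0, Pi.single i 1)
  rw [hvert, fderiv_fderiv_fderiv_rotate (contDiff_infty.1 hW 3),
    hsum _ (fderiv ℝ F _ (0, Pi.single i 1)), hsum _ (fderiv ℝ F _ (0, Pi.single j 1))] at hsecond
  rw [hderiv.deriv]
  simp only [Matrix.neg_apply, Matrix.add_apply, Matrix.mul_apply, Matrix.transpose_apply,
    hessx_eq_fderiv hW₁ hW₂, jacx_eq_fderiv hF₁]
  simp only [hsymm _ (0, Pi.single _ 1) (0, Pi.single j 1),
    mul_comm (fderiv ℝ (fderiv ℝ W) _ (0, Pi.single i 1) _)]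
  linarith
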